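/- arXiv:1410.2405 — 7 statements merged into one kernel-verified Lean document; each statement's English description precedes it below -/
import Mathlib

section
/- Let G be a finite simple graph, and let s ≥ 2 and t ≥ 1 be integers. Then t·gn(G,s) ≤ gn(G(t),s); equivalently, N(G(t),s) ≥ N(G,s)^t, where G(t) is the t-uniform blowup of G. -/
/-- A guessing strategy on graph `G` with alphabet `A`: each player `v` maps the
values of its neighbours to a guess of its own value. -/
def GuessStrategy {V : Type*} (G : SimpleGraph V) (A : Type*) : Type _ :=
  ∀ v : V, ((G.neighborSet v) → A) → A

/-- An assignment `a : V → A` is winning for the strategy `F` if every player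
guesses its own value correctly. -/
def WinningAssignment {V : Type*} {G : SimpleGraph V} {A : Type*}
    (F : GuessStrategy G A) (a : V → A) : Prop :=
  ∀ v : V, F v (fun u => a u.1) = a v

/-- The number of assignments won by strategy `F` in the game `(G, s)`. -/
noncomputable def winCount {V : Type*} (G : SimpleGraph V) (s : ℕ)
    (F : GuessStrategy G (Fin s)) : ℕ :=
  Nat.card {a : V → Fin s // WinningAssignment F a}

/-- `N(G,s)`: the maximum number of winning assignments over all strategies. -/
noncomputable def maxWinCount {V : Type*} (G : SimpleGraph V) (s : ℕ) : ℕ :=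
  sSup {n | ∃ F : GuessStrategy G (Fin s), winCount G s F = n}

/-- The guessing number `gn(G,s) = log_s N(G,s)`. -/
noncomputable def gn {V : Type*} (G : SimpleGraph V) (s : ℕ) : ℝ :=
  Real.logb s (maxWinCount G s)

/-- The `t`-uniform blowup of `G`. -/
def blowup {V : Type*} (G : SimpleGraph V) (t : ℕ) : SimpleGraph (V × Fin t) :=
  G.comap Prod.fst

/-- The strategy on the blowup which plays `F` independently on each of the `t` layers. -/
def GuessStrategy.blowup {V A : Type*} {G : SimpleGraph V} (F : GuessStrategy G A) (t : ℕ) :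
    GuessStrategy (_root_.blowup G t) A :=
  fun v h => F v.1 fun u => h ⟨(u.1, v.2), u.2⟩

/-- The assignments winning for `F.blowup t` are the `t`-tuples of assignments winning for `F`. -/
def winningAssignmentBlowupEquiv {V A : Type*} {G : SimpleGraph V} (F : GuessStrategy G A)
    (t : ℕ) :
    {a : V × Fin t → A // WinningAssignment (F.blowup t) a} ≃
      (Fin t → {a : V → A // WinningAssignment F a}) where
  toFun a i := ⟨fun v => a.1 (v, i), fun v => a.2 (v, i)⟩
  invFun b := ⟨fun v => (b v.2).1 v.1, fun v => (b v.2).2 v.1⟩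
  left_inv _ := rfl
  right_inv _ := rfl

theorem winCount_blowup {V : Type*} {G : SimpleGraph V} {s : ℕ} (F : GuessStrategy G (Fin s))
    (t : ℕ) : winCount (blowup G t) s (F.blowup t) = winCount G s F ^ t := by
  rw [winCount, Nat.card_congr (winningAssignmentBlowupEquiv F t), Nat.card_fun, Nat.card_fin,
    winCount]

theorem bddAbove_winCount {V : Type*} [Finite V] (G : SimpleGraph V) (s : ℕ) :
    BddAbove {n | ∃ F : GuessStrategy G (Fin s), winCount G s F = n} := by
  refine ⟨Nat.card (V → Fin s), ?_⟩
  rintro _ ⟨F, rfl⟩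
  exact Nat.card_le_card_of_injective _ Subtype.val_injective

theorem winCount_le_maxWinCount {V : Type*} [Finite V] {G : SimpleGraph V} {s : ℕ}
    (F : GuessStrategy G (Fin s)) : winCount G s F ≤ maxWinCount G s :=
  le_csSup (bddAbove_winCount G s) ⟨F, rfl⟩

theorem exists_winCount_eq_maxWinCount {V : Type*} [Finite V] (G : SimpleGraph V) (s : ℕ)
    [NeZero s] : ∃ F : GuessStrategy G (Fin s), winCount G s F = maxWinCount G s :=
  Nat.sSup_mem (s := {n | ∃ F : GuessStrategy G (Fin s), winCount G s F = n})
    ⟨_, fun _ _ => 0, rfl⟩ (bddAbove_winCount G s)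

theorem maxWinCount_pos {V : Type*} [Finite V] (G : SimpleGraph V) (s : ℕ) [NeZero s] :
    0 < maxWinCount G s := by
  let F : GuessStrategy G (Fin s) := fun _ _ => 0
  have : Nonempty {a : V → Fin s // WinningAssignment F a} := ⟨fun _ => 0, fun _ => rfl⟩
  exact lt_of_lt_of_le Nat.card_pos (winCount_le_maxWinCount F)

/-- For a finite simple graph G and integers s ≥ 2, t ≥ 1,
t·gn(G,s) ≤ gn(G(t),s); equivalently N(G(t),s) ≥ N(G,s)^t. -/
theorem blowup_guessing_number_lower_bound {V : Type*} [Fintype V] (G : SimpleGraph V)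
    (s t : ℕ) (hs : 2 ≤ s) (ht : 1 ≤ t) :
    maxWinCount G s ^ t ≤ maxWinCount (blowup G t) s ∧
      (t : ℝ) * gn G s ≤ gn (blowup G t) s := by
  have : NeZero s := ⟨by omega⟩
  have hN : maxWinCount G s ^ t ≤ maxWinCount (blowup G t) s := by
    obtain ⟨F, hF⟩ := exists_winCount_eq_maxWinCount G s
    rw [← hF, ← winCount_blowup]
    exact winCount_le_maxWinCount _
  refine ⟨hN, ?_⟩
  rw [gn, gn, ← Real.logb_pow]
  exact Real.logb_le_logb_of_le (by exact_mod_cast hs)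
    (by exact_mod_cast pow_pos (maxWinCount_pos G s) t) (by exact_mod_cast hN)
end

section
/- In a Steiner system S(3,6,22), any two distinct blocks intersect in either zero or two points. -/
namespace SteinerSystem

variable {P : Type*} [DecidableEq P] {B : Finset (Finset P)}

/-- Blocks sharing three distinct points coincide. -/
theorem block_eq_of_three_mem
    (hsteiner : ∀ t : Finset P, t.card = 3 → ∃! b, b ∈ B ∧ t ⊆ b)
    {x y z : P} (hxy : x ≠ y) (hxz : x ≠ z) (hyz : y ≠ z) {d e : Finset P}
    (hd : d ∈ B) (he : e ∈ B) (hxd : x ∈ d) (hyd : y ∈ d) (hzd : z ∈ d)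
    (hxe : x ∈ e) (hye : y ∈ e) (hze : z ∈ e) : d = e :=
  (hsteiner {x, y, z} (Finset.card_eq_three.2 ⟨x, y, z, hxy, hxz, hyz, rfl⟩)).unique
    ⟨hd, by simp [Finset.insert_subset_iff, *]⟩ ⟨he, by simp [Finset.insert_subset_iff, *]⟩

/-- Three distinct points lie in a common block. -/
theorem exists_block_of_three
    (hsteiner : ∀ t : Finset P, t.card = 3 → ∃! b, b ∈ B ∧ t ⊆ b)
    {x y z : P} (hxy : x ≠ y) (hxz : x ≠ z) (hyz : y ≠ z) :
    ∃ d ∈ B, x ∈ d ∧ y ∈ d ∧ z ∈ d := by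
  obtain ⟨d, ⟨hd, hsub⟩, -⟩ :=
    hsteiner {x, y, z} (Finset.card_eq_three.2 ⟨x, y, z, hxy, hxz, hyz, rfl⟩)
  exact ⟨d, hd, hsub (by simp), hsub (by simp), hsub (by simp)⟩

/-- Distinct blocks share at most two points. -/
theorem card_inter_le_two
    (hsteiner : ∀ t : Finset P, t.card = 3 → ∃! b, b ∈ B ∧ t ⊆ b)
    {b c : Finset P} (hb : b ∈ B) (hc : c ∈ B) (hbc : b ≠ c) : (b ∩ c).card ≤ 2 := by
  by_contra! h
  obtain ⟨t, ht, htc⟩ := Finset.exists_subset_card_eq (Nat.succ_le_of_lt h)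
  exact hbc ((hsteiner t htc).unique ⟨hb, ht.trans Finset.inter_subset_left⟩
    ⟨hc, ht.trans Finset.inter_subset_right⟩)

/-- At most five blocks pass through two given points. -/
theorem card_blocks_through_pair_le [Fintype P]
    (hP : Fintype.card P = 22) (hsize : ∀ b ∈ B, b.card = 6)
    (hsteiner : ∀ t : Finset P, t.card = 3 → ∃! b, b ∈ B ∧ t ⊆ b) {x y : P} (hxy : x ≠ y) :
    (B.filter fun d => x ∈ d ∧ y ∈ d).card ≤ 5 := by
  set D := B.filter fun d => x ∈ d ∧ y ∈ d with hD
  have hdisj : (D : Set (Finset P)).PairwiseDisjoint fun d => d \ {x, y} := by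
    intro d hd e he hne
    refine Finset.disjoint_left.2 fun z hzd hze => hne ?_
    rw [hD, Finset.mem_coe, Finset.mem_filter] at hd he
    simp only [Finset.mem_sdiff, Finset.mem_insert, Finset.mem_singleton, not_or] at hzd hze
    exact block_eq_of_three_mem hsteiner hxy (Ne.symm hzd.2.1) (Ne.symm hzd.2.2) hd.1 he.1
      hd.2.1 hd.2.2 hzd.1 he.2.1 he.2.2 hze.1
  have hcard : ∀ d ∈ D, (d \ {x, y}).card = 4 := by
    intro d hd
    rw [hD, Finset.mem_filter] at hd
    rw [Finset.card_sdiff_of_subset (by simp [Finset.insert_subset_iff, hd.2]),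
      hsize d hd.1, Finset.card_pair hxy]
  have hle := Finset.card_le_univ (D.biUnion fun d => d \ {x, y})
  rw [Finset.card_biUnion hdisj, Finset.sum_congr rfl hcard, Finset.sum_const, smul_eq_mul,
    hP] at hle
  omega

/-- Two blocks never meet in exactly one point. -/
theorem card_inter_ne_one [Fintype P]
    (hP : Fintype.card P = 22) (hsize : ∀ b ∈ B, b.card = 6)
    (hsteiner : ∀ t : Finset P, t.card = 3 → ∃! b, b ∈ B ∧ t ⊆ b)
    {b c : Finset P} (hb : b ∈ B) (hc : c ∈ B) : (b ∩ c).card ≠ 1 := by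
  intro h
  obtain ⟨x, hx⟩ := Finset.card_eq_one.1 h
  have hmem : ∀ z, z ∈ b → z ∈ c → z = x := fun z hzb hzc => by
    simpa [hx] using Finset.mem_inter.2 ⟨hzb, hzc⟩
  obtain ⟨hxb, hxc⟩ : x ∈ b ∧ x ∈ c := Finset.mem_inter.1 (by simp [hx])
  obtain ⟨y, hyc, hyx⟩ := Finset.exists_mem_ne (by rw [hsize c hc]; norm_num) x
  have hyb : y ∉ b := fun hyb => hyx (hmem y hyb hyc)
  have hex : ∀ z, ∃ d, z ∈ b.erase x → d ∈ B ∧ x ∈ d ∧ y ∈ d ∧ z ∈ d := by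
    intro z
    by_cases hz : z ∈ b.erase x
    · rw [Finset.mem_erase] at hz
      obtain ⟨d, hd⟩ := exists_block_of_three hsteiner hyx.symm hz.1.symm
        (fun hyz : y = z => hyb (hyz ▸ hz.2))
      exact ⟨d, fun _ => hd⟩
    · exact ⟨∅, fun h => absurd h hz⟩
  choose f hf using hex
  have hinj : Set.InjOn f (b.erase x) := by
    intro z hz w hw hzw
    by_contra hne
    obtain ⟨hd, hxd, hyd, hzd⟩ := hf z hz
    have hwd : w ∈ f z := hzw ▸ (hf w hw).2.2.2
    rw [Finset.mem_coe, Finset.mem_erase] at hz hw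
    have hbd := block_eq_of_three_mem hsteiner hz.1.symm hw.1.symm hne hb hd
      hxb hz.2 hw.2 hxd hzd hwd
    exact hyb (hbd ▸ hyd)
  have hmaps : ∀ z ∈ b.erase x, f z ∈ (B.filter fun d => x ∈ d ∧ y ∈ d).erase c := by
    intro z hz
    obtain ⟨hd, hxd, hyd, hzd⟩ := hf z hz
    rw [Finset.mem_erase] at hz
    exact Finset.mem_erase.2 ⟨fun hfc => hz.1 (hmem z hz.2 (hfc ▸ hzd)),
      Finset.mem_filter.2 ⟨hd, hxd, hyd⟩⟩
  have hle := Finset.card_le_card_of_injOn f hmaps hinj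
  rw [Finset.card_erase_of_mem hxb, hsize b hb,
    Finset.card_erase_of_mem (Finset.mem_filter.2 ⟨hc, hxc, hyc⟩)] at hle
  have := card_blocks_through_pair_le hP hsize hsteiner hyx.symm
  omega

end SteinerSystem

/-- In a Steiner system S(3,6,22), any two distinct blocks intersect in
zero or two points. -/
theorem steiner_3_6_22_block_intersection {P : Type*} [Fintype P] [DecidableEq P]
    (hP : Fintype.card P = 22) (B : Finset (Finset P))
    (hsize : ∀ b ∈ B, b.card = 6)
    (hsteiner : ∀ t : Finset P, t.card = 3 → ∃! b, b ∈ B ∧ t ⊆ b) :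
    ∀ b ∈ B, ∀ c ∈ B, b ≠ c → (b ∩ c).card = 0 ∨ (b ∩ c).card = 2 := by
  intro b hb c hc hbc
  have hle := SteinerSystem.card_inter_le_two hsteiner hb hc hbc
  have hne := SteinerSystem.card_inter_ne_one hP hsize hsteiner hb hc
  omega
end

section
/- In a Steiner system S(3,6,22), for every block B there are exactly 16 blocks disjoint from B. -/
open Finset in
/-- Double counting of the pairs `(t, c)` with `t` a `j`-subset of `s ∩ c` and `c ∈ B`. -/
lemma sum_choose_card_inter_eq {P : Type*} [DecidableEq P]
    (B : Finset (Finset P)) (s : Finset P) (j d : ℕ)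
    (h : ∀ t : Finset P, t.card = j → (B.filter (fun c => t ⊆ c)).card = d) :
    ∑ c ∈ B, (s ∩ c).card.choose j = s.card.choose j * d := by
  have key := sum_card_bipartiteAbove_eq_sum_card_bipartiteBelow
    (s := powersetCard j s) (t := B) (fun t c => t ⊆ c)
  have hleft : ∑ t ∈ powersetCard j s, (B.filter (fun c => t ⊆ c)).card
      = s.card.choose j * d := by
    rw [sum_congr rfl fun t ht => h t (mem_powersetCard.1 ht).2, sum_const,
      card_powersetCard, smul_eq_mul]
  rw [← hleft]
  refine Eq.trans (sum_congr rfl fun c _ => ?_) key.symm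
  rw [← card_powersetCard]
  congr 1
  ext t
  simp only [bipartiteBelow, mem_filter, mem_powersetCard, subset_inter_iff]
  tauto

open Finset in
/-- In a family of `k`-sets in which every `(j + 1)`-set has degree `d`, the degree of a `j`-set
is determined by double counting. -/
lemma card_filter_superset_mul {P : Type*} [Fintype P] [DecidableEq P]
    (B : Finset (Finset P)) (k j d : ℕ) (hsize : ∀ b ∈ B, b.card = k)
    (h : ∀ t : Finset P, t.card = j + 1 → (B.filter (fun c => t ⊆ c)).card = d)
    (t : Finset P) (ht : t.card = j) :
    (B.filter (fun c => t ⊆ c)).card * (k - j) = (Fintype.card P - j) * d := by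
  have key := sum_card_bipartiteAbove_eq_sum_card_bipartiteBelow
    (s := tᶜ) (t := B.filter (fun c => t ⊆ c)) (fun x c => x ∈ c)
  have hleft : ∀ x ∈ tᶜ,
      (bipartiteAbove (fun x c => x ∈ c) (B.filter (fun c => t ⊆ c)) x).card = d := by
    intro x hx
    rw [← h (insert x t) (by rw [card_insert_of_notMem (mem_compl.1 hx), ht])]
    congr 1
    ext c
    simp only [bipartiteAbove, mem_filter, insert_subset_iff]
    tauto
  have hright : ∀ c ∈ B.filter (fun c => t ⊆ c),
      (bipartiteBelow (fun x c => x ∈ c) tᶜ c).card = k - j := by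
    intro c hc
    rw [mem_filter] at hc
    rw [← hsize c hc.1, ← ht, ← card_sdiff_of_subset hc.2]
    congr 1
    ext x
    simp only [bipartiteBelow, mem_filter, mem_compl, mem_sdiff]
    tauto
  rw [sum_congr rfl hleft, sum_congr rfl hright, sum_const, sum_const, card_compl, ht,
    smul_eq_mul, smul_eq_mul] at key
  exact key.symm

/-- In a Steiner system S(3,6,22), each block is disjoint from exactly
16 blocks. -/
theorem steiner_3_6_22_sixteen_disjoint_blocks {P : Type*} [Fintype P] [DecidableEq P]
    (hP : Fintype.card P = 22) (B : Finset (Finset P))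
    (hsize : ∀ b ∈ B, b.card = 6)
    (hsteiner : ∀ t : Finset P, t.card = 3 → ∃! b, b ∈ B ∧ t ⊆ b) :
    ∀ b ∈ B, (B.filter (fun c => b ∩ c = ∅)).card = 16 := by
  intro b hb
  have deg3 : ∀ t : Finset P, t.card = 3 → (B.filter (fun c => t ⊆ c)).card = 1 := by
    intro t ht
    obtain ⟨c, hc, huniq⟩ := hsteiner t ht
    refine Finset.card_eq_one.2 ⟨c, ?_⟩
    ext e
    rw [Finset.mem_filter, Finset.mem_singleton]
    exact ⟨huniq e, fun h => h ▸ hc⟩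
  have deg2 : ∀ t : Finset P, t.card = 2 → (B.filter (fun c => t ⊆ c)).card = 5 := by
    intro t ht
    have := card_filter_superset_mul B 6 2 1 hsize deg3 t ht
    omega
  have deg1 : ∀ t : Finset P, t.card = 1 → (B.filter (fun c => t ⊆ c)).card = 21 := by
    intro t ht
    have := card_filter_superset_mul B 6 1 5 hsize deg2 t ht
    omega
  have deg0 : ∀ t : Finset P, t.card = 0 → (B.filter (fun c => t ⊆ c)).card = 77 := by
    intro t ht
    have := card_filter_superset_mul B 6 0 21 hsize deg1 t ht
    omega
  have sum0 := sum_choose_card_inter_eq B b 0 77 deg0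
  have sum1 := sum_choose_card_inter_eq B b 1 21 deg1
  have sum2 := sum_choose_card_inter_eq B b 2 5 deg2
  have sum3 := sum_choose_card_inter_eq B b 3 1 deg3
  have hlt : ∀ c ∈ B, c ≠ b → (b ∩ c).card < 3 := by
    intro c hc hne
    by_contra! hge
    obtain ⟨t, htsub, ht⟩ := Finset.exists_subset_card_eq hge
    rw [Finset.subset_inter_iff] at htsub
    exact hne ((hsteiner t ht).unique ⟨hc, htsub.2⟩ ⟨hb, htsub.1⟩)
  have pointwise : ∀ c ∈ B,
      (b ∩ c).card.choose 0 + (b ∩ c).card.choose 2 + (if c = b then 10 else 0)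
        = (b ∩ c).card.choose 1 + (b ∩ c).card.choose 3 + (if b ∩ c = ∅ then 1 else 0) := by
    intro c hc
    simp only [← Finset.card_eq_zero]
    by_cases hcb : c = b
    · subst hcb
      rw [Finset.inter_self, hsize c hc]
      simp
      decide
    · have := hlt c hc hcb
      rw [if_neg hcb]
      interval_cases (b ∩ c).card <;> decide
  have total := Finset.sum_congr rfl pointwise
  simp only [Finset.sum_add_distrib, sum0, sum1, sum2, sum3, Finset.sum_ite_eq' B b, if_pos hb,
    hsize b hb, ← Finset.card_filter] at total
  norm_num [Nat.choose] at total
  omega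
end

section
/- In a Steiner system S(3,6,22), no three blocks are pairwise disjoint. -/
/-- Blocks sharing at least three points are equal. -/
lemma steiner_3_6_22_eq_of_three_mem {P : Type*} {B : Finset (Finset P)}
    (hsteiner : ∀ t : Finset P, t.card = 3 → ∃! b, b ∈ B ∧ t ⊆ b) {b c : Finset P}
    (hb : b ∈ B) (hc : c ∈ B) {t : Finset P} (ht : 3 ≤ t.card) (htb : t ⊆ b) (htc : t ⊆ c) :
    b = c := by
  obtain ⟨s, hst, hs⟩ := Finset.exists_subset_card_eq ht
  exact (hsteiner s hs).unique ⟨hb, hst.trans htb⟩ ⟨hc, hst.trans htc⟩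

section SteinerSystem

variable {P : Type*} [Fintype P] [DecidableEq P] {B : Finset (Finset P)}

/-- Two points lie in exactly five common blocks. -/
lemma steiner_3_6_22_card_blocks_through_pair (hP : Fintype.card P = 22)
    (hsize : ∀ b ∈ B, b.card = 6)
    (hsteiner : ∀ t : Finset P, t.card = 3 → ∃! b, b ∈ B ∧ t ⊆ b) {p q : P} (hpq : p ≠ q) :
    (B.filter fun b => p ∈ b ∧ q ∈ b).card = 5 := by
  have key : ((Finset.univ.erase p).erase q).card * 1 =
      (B.filter fun b => p ∈ b ∧ q ∈ b).card * 4 := by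
    refine Finset.card_mul_eq_card_mul (fun z b => z ∈ b) ?_ ?_
    · intro z hz
      simp only [Finset.mem_erase, Finset.mem_univ, and_true] at hz
      obtain ⟨b, hb, hu⟩ := hsteiner {p, q, z}
        (Finset.card_eq_three.2 ⟨p, q, z, hpq, hz.2.symm, hz.1.symm, rfl⟩)
      refine Finset.card_eq_one.2 ⟨b, ?_⟩
      ext c
      simp only [Finset.mem_bipartiteAbove, Finset.mem_filter, Finset.mem_singleton]
      simp only [Finset.insert_subset_iff, Finset.singleton_subset_iff] at hb hu
      constructor
      · rintro ⟨⟨hc, hp, hq⟩, hz⟩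
        exact hu c ⟨hc, hp, hq, hz⟩
      · rintro rfl
        tauto
    · intro b hb
      obtain ⟨hb, hp, hq⟩ := Finset.mem_filter.1 hb
      have : Finset.bipartiteBelow (fun z b => z ∈ b) ((Finset.univ.erase p).erase q) b =
          (b.erase p).erase q := by
        ext z
        simp only [Finset.mem_bipartiteBelow, Finset.mem_erase, Finset.mem_univ]
        tauto
      rw [this, Finset.card_erase_of_mem (Finset.mem_erase.2 ⟨hpq.symm, hq⟩),
        Finset.card_erase_of_mem hp, hsize b hb]
  rw [Finset.card_erase_of_mem (Finset.mem_erase.2 ⟨hpq.symm, Finset.mem_univ q⟩),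
    Finset.card_erase_of_mem (Finset.mem_univ p), Finset.card_univ, hP] at key
  omega

/-- Every point lies in exactly 21 blocks. -/
lemma steiner_3_6_22_card_blocks_through_point (hP : Fintype.card P = 22)
    (hsize : ∀ b ∈ B, b.card = 6)
    (hsteiner : ∀ t : Finset P, t.card = 3 → ∃! b, b ∈ B ∧ t ⊆ b) (p : P) :
    (B.filter fun b => p ∈ b).card = 21 := by
  have key : (Finset.univ.erase p).card * 5 = (B.filter fun b => p ∈ b).card * 5 := by
    refine Finset.card_mul_eq_card_mul (fun z b => z ∈ b) ?_ ?_
    · intro q hq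
      rw [Finset.bipartiteAbove, Finset.filter_filter]
      exact steiner_3_6_22_card_blocks_through_pair hP hsize hsteiner (Finset.ne_of_mem_erase hq).symm
    · intro b hb
      obtain ⟨hb, hp⟩ := Finset.mem_filter.1 hb
      have : Finset.bipartiteBelow (fun z b => z ∈ b) (Finset.univ.erase p) b = b.erase p := by
        ext z
        simp only [Finset.mem_bipartiteBelow, Finset.mem_erase, Finset.mem_univ]
        tauto
      rw [this, Finset.card_erase_of_mem hp, hsize b hb]
  rw [Finset.card_erase_of_mem (Finset.mem_univ p), Finset.card_univ, hP] at key
  omega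

/-- Two distinct blocks meet in zero or two points. -/
lemma steiner_3_6_22_card_inter (hP : Fintype.card P = 22)
    (hsize : ∀ b ∈ B, b.card = 6)
    (hsteiner : ∀ t : Finset P, t.card = 3 → ∃! b, b ∈ B ∧ t ⊆ b) {x b : Finset P}
    (hx : x ∈ B) (hb : b ∈ B) (hxb : x ≠ b) : (x ∩ b).card = 0 ∨ (x ∩ b).card = 2 := by
  have hle : (x ∩ b).card < 3 := by
    by_contra! h
    exact hxb (steiner_3_6_22_eq_of_three_mem hsteiner hx hb h Finset.inter_subset_left
      Finset.inter_subset_right)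
  have hne : (x ∩ b).card ≠ 1 := by
    intro h
    obtain ⟨p, hp⟩ := Finset.card_eq_one.1 h
    have hpm : p ∈ x ∧ p ∈ b := Finset.mem_inter.1 (hp ▸ Finset.mem_singleton_self p)
    have hinter : ∀ z, z ∈ x → z ∈ b → z = p := fun z hzx hzb =>
      Finset.mem_singleton.1 (hp ▸ Finset.mem_inter.2 ⟨hzx, hzb⟩)
    obtain ⟨q, hqx, hqp⟩ := Finset.exists_mem_ne (by rw [hsize x hx]; norm_num) p
    have hqb : q ∉ b := fun hqb => hqp (hinter q hqx hqb)
    have hblock : ∀ z ∈ b.erase p, ∃ c ∈ B, p ∈ c ∧ q ∈ c ∧ z ∈ c := by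
      intro z hz
      obtain ⟨hzp, hzb⟩ := Finset.mem_erase.1 hz
      obtain ⟨c, hc, -⟩ := hsteiner {p, q, z} (Finset.card_eq_three.2
        ⟨p, q, z, hqp.symm, hzp.symm, fun h => hqb (h ▸ hzb), rfl⟩)
      simp only [Finset.insert_subset_iff, Finset.singleton_subset_iff] at hc
      exact ⟨c, hc⟩
    choose! f hfB hfp hfq hfz using hblock
    have hcard : (b.erase p).card ≤ ((B.filter fun c => p ∈ c ∧ q ∈ c).erase x).card := by
      refine Finset.card_le_card_of_injOn f ?_ ?_
      · intro z hz
        refine Finset.mem_coe.2 (Finset.mem_erase.2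
          ⟨fun h => ?_, Finset.mem_filter.2 ⟨hfB z hz, hfp z hz, hfq z hz⟩⟩)
        obtain ⟨hzp, hzb⟩ := Finset.mem_erase.1 hz
        exact hzp (hinter z (h ▸ hfz z hz) hzb)
      · intro z hz w hw hzw
        by_contra hne
        obtain ⟨hzp, hzb⟩ := Finset.mem_erase.1 hz
        obtain ⟨hwp, hwb⟩ := Finset.mem_erase.1 hw
        have heq : f z = b := by
          refine steiner_3_6_22_eq_of_three_mem hsteiner (hfB z hz) hb (t := {p, z, w})
            (Finset.card_eq_three.2 ⟨p, z, w, hzp.symm, hwp.symm, hne, rfl⟩).ge ?_ ?_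
          · simp only [Finset.insert_subset_iff, Finset.singleton_subset_iff]
            exact ⟨hfp z hz, hfz z hz, hzw ▸ hfz w hw⟩
          · simp only [Finset.insert_subset_iff, Finset.singleton_subset_iff]
            exact ⟨hpm.2, hzb, hwb⟩
        exact hqb (heq ▸ hfq z hz)
    rw [Finset.card_erase_of_mem hpm.2, hsize b hb,
      Finset.card_erase_of_mem (Finset.mem_filter.2 ⟨hx, hpm.1, hqx⟩),
      steiner_3_6_22_card_blocks_through_pair hP hsize hsteiner hqp.symm] at hcard
    omega
  omega

/-- Some block meets a given set of four points only in a given one of them. -/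
lemma steiner_3_6_22_exists_tangent_block (hP : Fintype.card P = 22)
    (hsize : ∀ b ∈ B, b.card = 6)
    (hsteiner : ∀ t : Finset P, t.card = 3 → ∃! b, b ∈ B ∧ t ⊆ b) {R : Finset P}
    (hR : R.card = 4) {p : P} (hp : p ∈ R) : ∃ x ∈ B, x ∩ R = {p} := by
  by_contra! h
  have hsub : (B.filter fun b => p ∈ b) ⊆
      (R.erase p).biUnion fun q => B.filter fun b => p ∈ b ∧ q ∈ b := by
    intro x hx
    obtain ⟨hx, hpx⟩ := Finset.mem_filter.1 hx
    obtain ⟨q, hq, hqp⟩ : ∃ q ∈ x ∩ R, q ≠ p := by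
      by_contra! hall
      exact h x hx (Finset.eq_singleton_iff_unique_mem.2
        ⟨Finset.mem_inter.2 ⟨hpx, hp⟩, hall⟩)
    obtain ⟨hqx, hqR⟩ := Finset.mem_inter.1 hq
    exact Finset.mem_biUnion.2
      ⟨q, Finset.mem_erase.2 ⟨hqp, hqR⟩, Finset.mem_filter.2 ⟨hx, hpx, hqx⟩⟩
  have hle := (Finset.card_le_card hsub).trans (Finset.card_biUnion_le_card_mul _ _ 5
    fun q hq => (steiner_3_6_22_card_blocks_through_pair hP hsize hsteiner
      (Finset.ne_of_mem_erase hq).symm).le)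
  rw [steiner_3_6_22_card_blocks_through_point hP hsize hsteiner p,
    Finset.card_erase_of_mem hp, hR] at hle
  omega

end SteinerSystem

/-- In a Steiner system S(3,6,22), no three distinct blocks are
pairwise disjoint. -/
theorem steiner_3_6_22_no_three_pairwise_disjoint {P : Type*} [Fintype P] [DecidableEq P]
    (hP : Fintype.card P = 22) (B : Finset (Finset P))
    (hsize : ∀ b ∈ B, b.card = 6)
    (hsteiner : ∀ t : Finset P, t.card = 3 → ∃! b, b ∈ B ∧ t ⊆ b) :
    ∀ b ∈ B, ∀ c ∈ B, ∀ d ∈ B, b ≠ c → b ≠ d → c ≠ d →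
      ¬ (b ∩ c = ∅ ∧ b ∩ d = ∅ ∧ c ∩ d = ∅) := by
  rintro b hb c hc d hd - - - ⟨hbc, hbd, hcd⟩
  rw [← Finset.disjoint_iff_inter_eq_empty] at hbc hbd hcd
  have hbcd : Disjoint (b ∪ c) d := Finset.disjoint_union_left.2 ⟨hbd, hcd⟩
  have hR : (b ∪ c ∪ d)ᶜ.card = 4 := by
    rw [Finset.card_compl, Finset.card_union_of_disjoint hbcd, Finset.card_union_of_disjoint hbc,
      hP, hsize b hb, hsize c hc, hsize d hd]
  obtain ⟨p, hp⟩ : (b ∪ c ∪ d)ᶜ.Nonempty := Finset.card_pos.1 (by omega)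
  obtain ⟨x, hx, hxR⟩ := steiner_3_6_22_exists_tangent_block hP hsize hsteiner hR hp
  have hpx : p ∈ x := (Finset.mem_inter.1 (hxR ▸ Finset.mem_singleton_self p)).1
  simp only [Finset.mem_compl, Finset.mem_union, not_or] at hp
  have hxb := steiner_3_6_22_card_inter hP hsize hsteiner hx hb fun h => hp.1.1 (h ▸ hpx)
  have hxc := steiner_3_6_22_card_inter hP hsize hsteiner hx hc fun h => hp.1.2 (h ▸ hpx)
  have hxd := steiner_3_6_22_card_inter hP hsize hsteiner hx hd fun h => hp.2 (h ▸ hpx)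
  have hunion : (x ∩ (b ∪ c ∪ d)).card = (x ∩ b).card + (x ∩ c).card + (x ∩ d).card := by
    rw [Finset.inter_union_distrib_left, Finset.inter_union_distrib_left,
      Finset.card_union_of_disjoint, Finset.card_union_of_disjoint]
    · exact hbc.mono Finset.inter_subset_right Finset.inter_subset_right
    · rw [← Finset.inter_union_distrib_left]
      exact hbcd.mono Finset.inter_subset_right Finset.inter_subset_right
  have hsplit := Finset.card_inter_add_card_sdiff x (b ∪ c ∪ d)
  rw [Finset.sdiff_eq_inter_compl, hxR, Finset.card_singleton, hsize x hx] at hsplit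
  omega
end

section
/- Let B be (the block set of) a Steiner system S(3,6,22) on a 22-element point set P, and let G be the graph whose vertex set is {∞} ∪ P ∪ B, where ∞ is adjacent to every point of P, a point p ∈ P is adjacent to a block b ∈ B if and only if p ∈ b, and two distinct blocks are adjacent if and only if they are disjoint. Then G has exactly 100 vertices and G is triangle-free (contains no clique on 3 vertices). -/
/-- Vertex set of the Higman–Sims graph built from a Steiner system S(3,6,22):
a distinguished vertex `∞` (i.e. `none`), the 22 points, and the 77 blocks. -/
abbrev HSVertex (P : Type*) (B : Finset (Finset P)) : Type _ :=
  Option (P ⊕ {b : Finset P // b ∈ B})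

/-- The Higman–Sims graph built from a Steiner system S(3,6,22): `∞` is joined to
every point, a point is joined to the blocks containing it, and two distinct blocks
are joined exactly when they are disjoint. -/
def higmanSims (P : Type*) [DecidableEq P] (B : Finset (Finset P)) :
    SimpleGraph (HSVertex P B) :=
  SimpleGraph.fromRel (fun x y =>
    match x, y with
    | none, some (Sum.inl _) => True
    | some (Sum.inl p), some (Sum.inr b) => p ∈ b.1
    | some (Sum.inr b), some (Sum.inr c) => b.1 ∩ c.1 = ∅
    | _, _ => False)

section Steiner

variable {P : Type*} [DecidableEq P] {B : Finset (Finset P)}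

/-- Double counting of pairs (triple, block containing it) in a Steiner triple cover. -/
theorem sum_card_filter_subset_of_steiner
    (h : ∀ t : Finset P, t.card = 3 → ∃! b, b ∈ B ∧ t ⊆ b)
    {ι : Type*} (T : Finset ι) (f : ι → Finset P) (hf : ∀ i ∈ T, (f i).card = 3) :
    ∑ b ∈ B, (T.filter fun i => f i ⊆ b).card = T.card := by
  refine (Finset.sum_card_bipartiteAbove_eq_sum_card_bipartiteBelow
    (fun i b => f i ⊆ b)).symm.trans ?_
  rw [Finset.card_eq_sum_ones]
  refine Finset.sum_congr rfl fun i hi => ?_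
  obtain ⟨b, hb, hu⟩ := h (f i) (hf i hi)
  refine Finset.card_eq_one.2 ⟨b, ?_⟩
  ext c
  simp only [Finset.bipartiteAbove, Finset.mem_filter, Finset.mem_singleton]
  exact ⟨hu c, fun hc => hc ▸ hb⟩

theorem card_steinerSystem_3_6_22 [Fintype P] (hP : Fintype.card P = 22)
    (hsize : ∀ b ∈ B, b.card = 6)
    (h : ∀ t : Finset P, t.card = 3 → ∃! b, b ∈ B ∧ t ⊆ b) : B.card = 77 := by
  have key := sum_card_filter_subset_of_steiner h (Finset.powersetCard 3 Finset.univ) id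
    fun t ht => (Finset.mem_powersetCard.1 ht).2
  have hb : ∀ b ∈ B,
      ((Finset.powersetCard 3 Finset.univ).filter fun t => id t ⊆ b).card = 20 := by
    intro b hb
    have : ((Finset.powersetCard 3 Finset.univ).filter fun t => id t ⊆ b) =
        Finset.powersetCard 3 b := by
      ext t
      simp [Finset.mem_powersetCard, and_comm]
    rw [this, Finset.card_powersetCard, hsize b hb]
    rfl
  rw [Finset.sum_congr rfl hb, Finset.card_powersetCard, Finset.card_univ, hP,
    Finset.sum_const, smul_eq_mul, show Nat.choose 22 3 = 1540 by decide] at key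
  omega

theorem sum_card_offDiag_inter_mul_card_inter
    (h : ∀ t : Finset P, t.card = 3 → ∃! b, b ∈ B ∧ t ⊆ b)
    {X Y : Finset P} (hXY : Disjoint X Y) :
    ∑ b ∈ B, (X ∩ b).offDiag.card * (Y ∩ b).card = X.offDiag.card * Y.card := by
  rw [← Finset.card_product, ← sum_card_filter_subset_of_steiner h (X.offDiag ×ˢ Y)
    (fun t => {t.1.1, t.1.2, t.2})]
  · refine Finset.sum_congr rfl fun b _ => ?_
    rw [← Finset.card_product]
    congr 1
    ext ⟨⟨x, y⟩, z⟩
    simp only [Finset.mem_product, Finset.mem_offDiag, Finset.mem_inter, Finset.mem_filter,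
      Finset.insert_subset_iff, Finset.singleton_subset_iff]
    tauto
  · rintro ⟨⟨x, y⟩, z⟩ ht
    simp only [Finset.mem_product, Finset.mem_offDiag] at ht
    obtain ⟨⟨hx, hy, hxy⟩, hz⟩ := ht
    exact Finset.card_eq_three.2 ⟨x, y, z, hxy, Finset.disjoint_iff_ne.1 hXY x hx z hz,
      Finset.disjoint_iff_ne.1 hXY y hy z hz, rfl⟩

theorem sum_card_inter_mul_card_inter_mul_card_inter
    (h : ∀ t : Finset P, t.card = 3 → ∃! b, b ∈ B ∧ t ⊆ b)
    {X Y Z : Finset P} (hXY : Disjoint X Y) (hXZ : Disjoint X Z) (hYZ : Disjoint Y Z) :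
    ∑ b ∈ B, (X ∩ b).card * ((Y ∩ b).card * (Z ∩ b).card) =
      X.card * (Y.card * Z.card) := by
  rw [← Finset.card_product, ← Finset.card_product,
    ← sum_card_filter_subset_of_steiner h (X ×ˢ Y ×ˢ Z) (fun t => {t.1, t.2.1, t.2.2})]
  · refine Finset.sum_congr rfl fun b _ => ?_
    rw [← Finset.card_product, ← Finset.card_product]
    congr 1
    ext ⟨x, y, z⟩
    simp only [Finset.mem_product, Finset.mem_inter, Finset.mem_filter,
      Finset.insert_subset_iff, Finset.singleton_subset_iff]
    tauto
  · rintro ⟨x, y, z⟩ ht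
    simp only [Finset.mem_product] at ht
    obtain ⟨hx, hy, hz⟩ := ht
    exact Finset.card_eq_three.2 ⟨x, y, z, Finset.disjoint_iff_ne.1 hXY x hx y hy,
      Finset.disjoint_iff_ne.1 hXZ x hx z hz, Finset.disjoint_iff_ne.1 hYZ y hy z hz, rfl⟩

theorem card_inter_le_two_of_steiner
    (h : ∀ t : Finset P, t.card = 3 → ∃! b, b ∈ B ∧ t ⊆ b)
    {b c : Finset P} (hb : b ∈ B) (hc : c ∈ B) (hbc : b ≠ c) : (b ∩ c).card ≤ 2 := by
  by_contra! hlt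
  obtain ⟨t, ht, ht3⟩ := Finset.exists_subset_card_eq (Nat.succ_le_of_lt hlt)
  exact hbc ((h t ht3).unique ⟨hb, ht.trans Finset.inter_subset_left⟩
    ⟨hc, ht.trans Finset.inter_subset_right⟩)

/-- Writing `α, γ, δ` for the intersection numbers of a block with three disjoint blocks, the sum
of `α(α-1)(6-α) + αγδ - 2α(α-1)(γ+δ)` over all blocks would be negative, although every
summand is nonnegative. -/
theorem not_pairwise_disjoint_blocks [Fintype P] (hP : Fintype.card P = 22)
    (hsize : ∀ b ∈ B, b.card = 6)
    (h : ∀ t : Finset P, t.card = 3 → ∃! b, b ∈ B ∧ t ⊆ b)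
    {X Y Z : Finset P} (hX : X ∈ B) (hY : Y ∈ B) (hZ : Z ∈ B)
    (hXY : Disjoint X Y) (hXZ : Disjoint X Z) (hYZ : Disjoint Y Z) : False := by
  have hc := sum_card_offDiag_inter_mul_card_inter h (disjoint_compl_right (a := X))
  have hy := sum_card_offDiag_inter_mul_card_inter h hXY
  have hz := sum_card_offDiag_inter_mul_card_inter h hXZ
  have hxyz := sum_card_inter_mul_card_inter_mul_card_inter h hXY hXZ hYZ
  rw [Finset.offDiag_card, Finset.card_compl, hP, hsize X hX] at hc
  rw [Finset.offDiag_card, hsize X hX, hsize Y hY] at hy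
  rw [Finset.offDiag_card, hsize X hX, hsize Z hZ] at hz
  rw [hsize X hX, hsize Y hY, hsize Z hZ] at hxyz
  have hle : ∑ b ∈ B, (2 * ((X ∩ b).offDiag.card * (Y ∩ b).card) +
        2 * ((X ∩ b).offDiag.card * (Z ∩ b).card)) ≤
      ∑ b ∈ B, ((X ∩ b).offDiag.card * (Xᶜ ∩ b).card +
        (X ∩ b).card * ((Y ∩ b).card * (Z ∩ b).card)) := by
    refine Finset.sum_le_sum fun b hb => ?_
    have zero_of_eq : ∀ {U V : Finset P}, Disjoint U V → b = V → (U ∩ b).card = 0 := by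
      rintro U V hUV rfl
      rw [Finset.disjoint_iff_inter_eq_empty.1 hUV, Finset.card_empty]
    have hsum : (X ∩ b).card + (Xᶜ ∩ b).card = 6 := by
      rw [← hsize b hb, ← Finset.card_inter_add_card_sdiff b X, Finset.inter_comm X b,
        Finset.inter_comm Xᶜ b, Finset.sdiff_eq_inter_compl]
    rw [Finset.offDiag_card]
    by_cases hbX : b = X
    · rw [zero_of_eq hXY.symm hbX, zero_of_eq hXZ.symm hbX]
      simp
    by_cases hbY : b = Y
    · rw [zero_of_eq hXY hbY]
      simp
    by_cases hbZ : b = Z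
    · rw [zero_of_eq hXZ hbZ]
      simp
    have hα := card_inter_le_two_of_steiner h hX hb (Ne.symm hbX)
    have hγ := card_inter_le_two_of_steiner h hY hb (Ne.symm hbY)
    have hδ := card_inter_le_two_of_steiner h hZ hb (Ne.symm hbZ)
    generalize (X ∩ b).card = α at *
    generalize (Y ∩ b).card = γ at *
    generalize (Z ∩ b).card = δ at *
    interval_cases α <;> interval_cases γ <;> interval_cases δ <;> omega
  rw [Finset.sum_add_distrib, Finset.sum_add_distrib, ← Finset.mul_sum, ← Finset.mul_sum,
    hc, hy, hz, hxyz] at hle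
  omega

end Steiner

/-- The Higman–Sims graph built from a Steiner system S(3,6,22) has
exactly 100 vertices and is triangle-free. -/
theorem higmanSims_card_and_triangleFree {P : Type*} [Fintype P] [DecidableEq P]
    (hP : Fintype.card P = 22) (B : Finset (Finset P))
    (hsize : ∀ b ∈ B, b.card = 6)
    (hsteiner : ∀ t : Finset P, t.card = 3 → ∃! b, b ∈ B ∧ t ⊆ b) :
    Fintype.card (HSVertex P B) = 100 ∧ (higmanSims P B).CliqueFree 3 := by
  refine ⟨?_, fun s hs => ?_⟩
  · simp [hP, card_steinerSystem_3_6_22 hP hsize hsteiner]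
  · obtain ⟨x, y, z, hxy, hxz, hyz, -⟩ := SimpleGraph.is3Clique_iff.1 hs
    have sep : ∀ {b c : Finset P}, b ∩ c = ∅ ∨ c ∩ b = ∅ → Disjoint b c := fun h =>
      h.elim Finset.disjoint_iff_inter_eq_empty.2
        fun h' => (Finset.disjoint_iff_inter_eq_empty.2 h').symm
    rcases x with _ | x | ⟨x, hx⟩ <;> rcases y with _ | y | ⟨y, hy⟩ <;>
      rcases z with _ | z | ⟨z, hz⟩ <;>
      simp only [higmanSims, SimpleGraph.fromRel_adj, or_self, or_false, false_or,
        and_false] at hxy hxz hyz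
    · exact Finset.disjoint_left.1 (sep hyz.2) hxy.2 hxz.2
    · exact Finset.disjoint_left.1 (sep hxz.2) hxy.2 hyz.2
    · exact Finset.disjoint_left.1 (sep hxy.2) hxz.2 hyz.2
    · exact not_pairwise_disjoint_blocks hP hsize hsteiner hx hy hz
        (sep hxy.2) (sep hxz.2) (sep hyz.2)
end

section
/- Let G be the Higman–Sims graph constructed from a Steiner system S(3,6,22), with adjacency matrix A (a 100×100 matrix). Then the matrix A + I, regarded as a matrix over the finite field F_3 = ZMod 3, has rank 23. -/
section SteinerSystem

variable {P : Type*} [DecidableEq P] {B : Finset (Finset P)}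

theorem eq_of_three_le_card_inter
    (hsteiner : ∀ t : Finset P, t.card = 3 → ∃! b, b ∈ B ∧ t ⊆ b)
    {b c : Finset P} (hb : b ∈ B) (hc : c ∈ B) (h : 3 ≤ (b ∩ c).card) : b = c := by
  obtain ⟨t, ht, ht3⟩ := Finset.exists_subset_card_eq h
  exact (hsteiner t ht3).unique ⟨hb, ht.trans Finset.inter_subset_left⟩
    ⟨hc, ht.trans Finset.inter_subset_right⟩

theorem eq_of_mem_three
    (hsteiner : ∀ t : Finset P, t.card = 3 → ∃! b, b ∈ B ∧ t ⊆ b)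
    {b c : Finset P} (hb : b ∈ B) (hc : c ∈ B) {x y z : P} (hxy : x ≠ y) (hxz : x ≠ z)
    (hyz : y ≠ z) (hxb : x ∈ b) (hyb : y ∈ b) (hzb : z ∈ b) (hxc : x ∈ c) (hyc : y ∈ c)
    (hzc : z ∈ c) : b = c := by
  refine (hsteiner {x, y, z} (Finset.card_eq_three.2 ⟨x, y, z, hxy, hxz, hyz, rfl⟩)).unique
    ⟨hb, ?_⟩ ⟨hc, ?_⟩ <;> simp [Finset.insert_subset_iff, *]

theorem exists_block_of_ne
    (hsteiner : ∀ t : Finset P, t.card = 3 → ∃! b, b ∈ B ∧ t ⊆ b)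
    {x y z : P} (hxy : x ≠ y) (hxz : x ≠ z) (hyz : y ≠ z) :
    ∃ b ∈ B, x ∈ b ∧ y ∈ b ∧ z ∈ b := by
  obtain ⟨b, ⟨hb, hs⟩, -⟩ :=
    hsteiner {x, y, z} (Finset.card_eq_three.2 ⟨x, y, z, hxy, hxz, hyz, rfl⟩)
  exact ⟨b, hb, hs (by simp), hs (by simp), hs (by simp)⟩

/-- Two blocks of an S(3,6,22) never meet in exactly one point. -/
theorem card_inter_ne_one [Fintype P] (hP : Fintype.card P = 22)
    (hsize : ∀ b ∈ B, b.card = 6)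
    (hsteiner : ∀ t : Finset P, t.card = 3 → ∃! b, b ∈ B ∧ t ⊆ b)
    {b c : Finset P} (hb : b ∈ B) (hc : c ∈ B) : (b ∩ c).card ≠ 1 := by
  intro h
  obtain ⟨p, hp⟩ := Finset.card_eq_one.1 h
  have hmem : ∀ y, y ∈ b → y ∈ c → y = p := fun y hyb hyc => by
    simpa [hp] using Finset.mem_inter.2 ⟨hyb, hyc⟩
  obtain ⟨hpb, hpc⟩ : p ∈ b ∧ p ∈ c := Finset.mem_inter.1 (by simp [hp])
  obtain ⟨x, hxc, hxp⟩ := Finset.exists_mem_ne (by rw [hsize c hc]; norm_num) p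
  have hxb : x ∉ b := fun hxb => hxp (hmem x hxb hxc)
  obtain ⟨z, hz⟩ : (c \ {p, x}).Nonempty := by
    rw [← Finset.card_pos]
    have := Finset.le_card_sdiff {p, x} c
    have := hsize c hc
    have := Finset.card_le_two (a := p) (b := x)
    omega
  simp only [Finset.mem_sdiff, Finset.mem_insert, Finset.mem_singleton, not_or] at hz
  obtain ⟨hzc, hzp, hzx⟩ := hz
  have hex : ∀ y ∈ b.erase p, ∃ d ∈ B, p ∈ d ∧ x ∈ d ∧ y ∈ d := fun y hy =>
    exists_block_of_ne hsteiner hxp.symm (Finset.ne_of_mem_erase hy).symm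
      fun hxy => hxb (hxy ▸ Finset.mem_of_mem_erase hy)
  choose! f hfB hpf hxf hyf using hex
  have hinj : ∀ y ∈ b.erase p, ∀ y' ∈ b.erase p, y ≠ y' → f y ≠ f y' := by
    intro y hy y' hy' hne heq
    have hbf : b = f y := eq_of_mem_three hsteiner hb (hfB y hy)
      (Finset.ne_of_mem_erase hy).symm (Finset.ne_of_mem_erase hy').symm hne hpb
      (Finset.mem_of_mem_erase hy) (Finset.mem_of_mem_erase hy') (hpf y hy) (hyf y hy)
      (heq ▸ hyf y' hy')
    exact hxb (hbf ▸ hxf y hy)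
  have hcard : ((b.erase p).biUnion fun y => f y \ {p, x}).card = 20 := by
    rw [Finset.card_biUnion]
    · rw [Finset.sum_congr rfl (g := fun _ => 4), Finset.sum_const,
        Finset.card_erase_of_mem hpb, hsize b hb]
      · rfl
      · intro y hy
        rw [Finset.card_sdiff_of_subset (by simp [Finset.insert_subset_iff, hpf y hy, hxf y hy]),
          hsize _ (hfB y hy), Finset.card_pair hxp.symm]
    · intro y hy y' hy' hne
      refine Finset.disjoint_left.2 ?_
      intro w hw hw'
      simp only [Finset.mem_sdiff, Finset.mem_insert, Finset.mem_singleton, not_or] at hw hw'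
      exact hinj y hy y' hy' hne (eq_of_mem_three hsteiner (hfB y hy) (hfB y' hy') hxp.symm
        (Ne.symm hw.2.1) (Ne.symm hw.2.2) (hpf y hy) (hxf y hy) hw.1 (hpf y' hy') (hxf y' hy')
        hw'.1)
  have hcover : ((b.erase p).biUnion fun y => f y \ {p, x}) = Finset.univ \ {p, x} := by
    refine Finset.eq_of_subset_of_card_le (fun w hw => ?_) ?_
    · obtain ⟨y, -, hy⟩ := Finset.mem_biUnion.1 hw
      exact Finset.sdiff_subset_sdiff (Finset.subset_univ _) subset_rfl hy
    · rw [hcard, Finset.card_sdiff_of_subset (Finset.subset_univ _), Finset.card_univ, hP,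
        Finset.card_pair hxp.symm]
  have hzU : z ∈ (b.erase p).biUnion fun y => f y \ {p, x} := by
    rw [hcover]
    simp [hzp, hzx]
  obtain ⟨y, hy, hzy⟩ := Finset.mem_biUnion.1 hzU
  have hfc : f y = c := eq_of_mem_three hsteiner (hfB y hy) hc hxp.symm (Ne.symm hzp)
    (Ne.symm hzx) (hpf y hy) (hxf y hy) (Finset.mem_sdiff.1 hzy).1 hpc hxc hzc
  exact Finset.ne_of_mem_erase hy (hmem y (Finset.mem_of_mem_erase hy) (hfc ▸ hyf y hy))

/-- Two distinct blocks of an S(3,6,22) meet in `0` or `2` points. -/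
theorem card_inter_eq_zero_or_two [Fintype P] (hP : Fintype.card P = 22)
    (hsize : ∀ b ∈ B, b.card = 6)
    (hsteiner : ∀ t : Finset P, t.card = 3 → ∃! b, b ∈ B ∧ t ⊆ b)
    {b c : Finset P} (hb : b ∈ B) (hc : c ∈ B) (hne : b ≠ c) :
    (b ∩ c).card = 0 ∨ (b ∩ c).card = 2 := by
  have h1 := card_inter_ne_one hP hsize hsteiner hb hc
  have h3 : ¬ 3 ≤ (b ∩ c).card := fun h => hne (eq_of_three_le_card_inter hsteiner hb hc h)
  omega

end SteinerSystem

theorem Matrix.rank_transpose_mul_self_of_mul_eq_one {m n R : Type*} [Fintype m] [Fintype n]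
    [DecidableEq m] [Field R] {W : Matrix m n R} {X : Matrix n m R} (h : W * X = 1) :
    (W.transpose * W).rank = Fintype.card m := by
  refine le_antisymm ((Matrix.rank_mul_le_right _ _).trans (Matrix.rank_le_card_height W)) ?_
  have hone : X.transpose * ((W.transpose * W) * X) = 1 := by
    rw [Matrix.mul_assoc, h, Matrix.mul_one, ← Matrix.transpose_mul, h, Matrix.transpose_one]
  calc Fintype.card m = (1 : Matrix m m R).rank := Matrix.rank_one.symm
    _ ≤ ((W.transpose * W) * X).rank := hone ▸ Matrix.rank_mul_le_right _ _
    _ ≤ _ := Matrix.rank_mul_le_left _ _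

/-- The matrix whose columns are the vectors attached to the vertices in the Gram representation
of the Higman–Sims graph modulo `3`: the coordinates indexed by `P` of the vector of `∞`, of a
point `p`, of a block `b` are the indicator functions of `P`, `{p}`, `b`, and the extra
coordinate `none` tells the blocks from the other vertices. -/
def higmanSimsGram (P : Type*) [DecidableEq P] (B : Finset (Finset P)) :
    Matrix (Option P) (HSVertex P B) (ZMod 3) :=
  Matrix.of fun i v =>
    match i, v with
    | none, some (Sum.inr _) => 1
    | none, _ => 0
    | some _, none => 1
    | some q, some (Sum.inl p) => if q = p then 1 else 0
    | some q, some (Sum.inr b) => if q ∈ b.1 then 1 else 0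

/-- A right inverse of `higmanSimsGram P B` supported on the points and the block `b₀`. -/
def higmanSimsGramInv {P : Type*} [DecidableEq P] {B : Finset (Finset P)}
    (b₀ : {b : Finset P // b ∈ B}) : Matrix (HSVertex P B) (Option P) (ZMod 3) :=
  Matrix.of fun v i =>
    match v, i with
    | some (Sum.inl p), some q => if p = q then 1 else 0
    | some (Sum.inl p), none => if p ∈ b₀.1 then -1 else 0
    | some (Sum.inr b), none => if b = b₀ then 1 else 0
    | _, _ => 0

theorem higmanSimsGram_mul_higmanSimsGramInv {P : Type*} [Fintype P] [DecidableEq P]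
    {B : Finset (Finset P)} (b₀ : {b : Finset P // b ∈ B}) :
    higmanSimsGram P B * higmanSimsGramInv b₀ = 1 := by
  ext i j
  rw [Matrix.mul_apply, Fintype.sum_option, Fintype.sum_sum_type]
  rcases i with _ | p <;> rcases j with _ | q <;>
    simp [higmanSimsGram, higmanSimsGramInv, Matrix.one_apply]

open scoped Classical in
theorem higmanSims_adjMatrix_add_one_eq {P : Type*} [Fintype P] [DecidableEq P]
    (hP : Fintype.card P = 22) {B : Finset (Finset P)}
    (hsize : ∀ b ∈ B, b.card = 6)
    (hsteiner : ∀ t : Finset P, t.card = 3 → ∃! b, b ∈ B ∧ t ⊆ b) :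
    (higmanSims P B).adjMatrix (ZMod 3) + 1 =
      (higmanSimsGram P B).transpose * higmanSimsGram P B := by
  have h22 : (22 : ZMod 3) = 1 := by decide
  have h6 : (6 : ZMod 3) = 0 := by decide
  ext u v
  rw [Matrix.mul_apply, Fintype.sum_option, Matrix.add_apply, SimpleGraph.adjMatrix_apply]
  rcases u with _ | p | ⟨b, hb⟩ <;> rcases v with _ | q | ⟨c, hc⟩
  case some.inl.some.inl => simp [higmanSimsGram, higmanSims, Matrix.one_apply, eq_comm]
  case some.inr.some.inr =>
    by_cases hbc : b = c
    · subst hbc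
      simp [higmanSimsGram, higmanSims, hsize b hb, h6]
    · have h12 : (1 + 2 : ZMod 3) = 0 := by decide
      rcases card_inter_eq_zero_or_two hP hsize hsteiner hb hc hbc with h | h
      · have he : b ∩ c = ∅ := Finset.card_eq_zero.1 h
        simp [higmanSimsGram, higmanSims, hbc, he, Finset.inter_comm c b]
      · have he : b ∩ c ≠ ∅ := fun he => by simp [he] at h
        simp [higmanSimsGram, higmanSims, hbc, h, he, h12, Finset.inter_comm c b]
  all_goals
    simp [higmanSimsGram, higmanSims, *]

open scoped Classical in
/-- For the Higman–Sims graph with adjacency matrix A, the matrix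
A + I over the field F_3 = ZMod 3 has rank 23. -/
theorem higmanSims_adjMatrix_add_one_rank {P : Type*} [Fintype P] [DecidableEq P]
    (hP : Fintype.card P = 22) (B : Finset (Finset P))
    (hsize : ∀ b ∈ B, b.card = 6)
    (hsteiner : ∀ t : Finset P, t.card = 3 → ∃! b, b ∈ B ∧ t ⊆ b) :
    ((higmanSims P B).adjMatrix (ZMod 3) + 1).rank = 23 := by
  obtain ⟨t, -, ht⟩ := Finset.exists_subset_card_eq
    (s := (Finset.univ : Finset P)) (n := 3) (by rw [Finset.card_univ, hP]; norm_num)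
  obtain ⟨b₀, ⟨hb₀, -⟩, -⟩ := hsteiner t ht
  rw [higmanSims_adjMatrix_add_one_eq hP hsize hsteiner,
    Matrix.rank_transpose_mul_self_of_mul_eq_one
      (higmanSimsGram_mul_higmanSimsGramInv ⟨b₀, hb₀⟩), Fintype.card_option, hP]
end

section
/- Let G be the Higman–Sims graph constructed from a Steiner system S(3,6,22), with adjacency matrix A, and set B = A + I regarded as a matrix over the finite field F_3 = ZMod 3. Then B² = 2B; in particular the minimal polynomial of B is a product of distinct linear factors, so B is diagonalisable over F_3. -/
namespace Matrix

/-- A basis of eigenvectors diagonalises a matrix. -/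
theorem exists_isUnit_isDiag_of_basis {K n : Type*} [Field K] [Fintype n] [DecidableEq n]
    {A : Matrix n n K} (v : Module.Basis n K (n → K)) (c : n → K)
    (h : ∀ i, A *ᵥ v i = c i • v i) :
    ∃ Q : Matrix n n K, IsUnit Q ∧ (Q⁻¹ * A * Q).IsDiag := by
  let Q : Matrix n n K := (Pi.basisFun K n).toMatrix v
  have hinv : v.toMatrix (Pi.basisFun K n) * Q = 1 := v.toMatrix_mul_toMatrix_flip _
  have hQ : IsUnit Q := IsUnit.of_mul_eq_one_right _ hinv
  refine ⟨Q, hQ, ?_⟩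
  have hcomm : A * Q = Q * diagonal c := by
    ext i j
    rw [mul_diagonal]
    simpa [Q, Module.Basis.toMatrix_apply, mul_apply, mulVec, dotProduct, mul_comm]
      using congrFun (h j) i
  rw [mul_assoc, hcomm, ← mul_assoc, nonsing_inv_mul Q ((isUnit_iff_isUnit_det Q).mp hQ),
    one_mul]
  exact isDiag_diagonal c

/-- An idempotent matrix over a field is diagonalisable. -/
theorem exists_isUnit_isDiag_of_isIdempotentElem {K n : Type*} [Field K] [Fintype n]
    [DecidableEq n] {E : Matrix n n K} (hE : IsIdempotentElem E) :
    ∃ Q : Matrix n n K, IsUnit Q ∧ (Q⁻¹ * E * Q).IsDiag := by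
  have hf : IsIdempotentElem E.toLin' := by
    rw [IsIdempotentElem, Module.End.mul_eq_comp, ← toLin'_mul, hE.eq]
  let w := ((Module.finBasis K E.toLin'.range).prod (Module.finBasis K E.toLin'.ker)).map
    (Submodule.prodEquivOfIsCompl _ _ (LinearMap.IsIdempotentElem.isCompl hf))
  let e := w.indexEquiv (Pi.basisFun K n)
  refine exists_isUnit_isDiag_of_basis (w.reindex e)
    (fun i => Sum.elim (fun _ => 1) (fun _ => 0) (e.symm i)) fun i => ?_
  rw [Module.Basis.reindex_apply]
  cases e.symm i with
  | inl j =>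
    have hj := (LinearMap.IsIdempotentElem.mem_range_iff hf).mp
      (Module.finBasis K E.toLin'.range j).2
    simpa [w] using hj
  | inr j =>
    have hj := LinearMap.mem_ker.mp (Module.finBasis K E.toLin'.ker j).2
    simpa [w, -LinearMap.map_coe_ker] using hj

/-- The symmetric block matrix with rows `(1, 1, 0)`, `(1, I, N)`, `(0, Nᵀ, J + NᵀN)`. -/
def borderedGram {R P β : Type*} [Semiring R] [Fintype P] [DecidableEq P] (N : Matrix P β R) :
    Matrix (Option (P ⊕ β)) (Option (P ⊕ β)) R
  | none, none => 1
  | none, some (Sum.inl _) => 1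
  | none, some (Sum.inr _) => 0
  | some (Sum.inl _), none => 1
  | some (Sum.inl p), some (Sum.inl q) => (1 : Matrix P P R) p q
  | some (Sum.inl p), some (Sum.inr b) => N p b
  | some (Sum.inr _), none => 0
  | some (Sum.inr b), some (Sum.inl p) => N p b
  | some (Sum.inr b), some (Sum.inr c) => 1 + (Nᵀ * N) b c

theorem borderedGram_mul_self {R P β : Type*} [CommRing R] [Fintype P] [DecidableEq P]
    [Fintype β] {N : Matrix P β R} (hP : (Fintype.card P : R) = 1)
    (hβ : (Fintype.card β : R) = 2) (hcol : ∀ b, ∑ p, N p b = 0) (hrow : ∀ p, ∑ b, N p b = 0)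
    (hN : N * Nᵀ = 1 - of fun _ _ => 1) :
    borderedGram N * borderedGram N = (2 : R) • borderedGram N := by
  have hNN : N * (Nᵀ * N) = N := by
    rw [← Matrix.mul_assoc, hN, Matrix.sub_mul, Matrix.one_mul, sub_eq_self]
    ext p b
    simpa [mul_apply] using hcol b
  have hgram : (Nᵀ * N) * (Nᵀ * N) = Nᵀ * N := by rw [Matrix.mul_assoc, hNN]
  have hsymm (b c : β) : (Nᵀ * N) b c = (Nᵀ * N) c b := by
    simp [mul_apply, mul_comm]
  have hsum (b : β) : ∑ c, (Nᵀ * N) b c = 0 := by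
    simp only [mul_apply, transpose_apply]
    rw [Finset.sum_comm]
    simp [← Finset.mul_sum, hrow]
  have hsum' (b : β) : ∑ c, (Nᵀ * N) c b = 0 := by
    simp_rw [hsymm _ b, hsum]
  have hNN' (p : P) (b : β) : ∑ c, N p c * (Nᵀ * N) c b = N p b := by
    rw [← mul_apply, hNN]
  have hNN'' (p : P) (b : β) : ∑ c, (Nᵀ * N) b c * N p c = N p b := by
    simp_rw [mul_comm, hsymm b, hNN']
  have hN' (p q : P) : ∑ b, N p b * N q b = (1 : Matrix P P R) p q - 1 := by
    simpa [mul_apply] using congrFun (congrFun hN p) q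
  have hgram' (b c : β) : ∑ d, (Nᵀ * N) b d * (Nᵀ * N) d c = (Nᵀ * N) b c := by
    rw [← mul_apply, hgram]
  have hS (b c : β) : ∑ p, N p b * N p c = (Nᵀ * N) b c := rfl
  ext x y
  rw [mul_apply, smul_apply, Fintype.sum_option, Fintype.sum_sum_type]
  rcases x with _ | p | b <;> rcases y with _ | q | c <;>
    simp only [borderedGram, mul_add, add_mul, mul_one, one_mul, mul_zero, zero_mul,
      Finset.sum_add_distrib, hcol, hrow, hsum, hsum', hNN', hNN'', hN', hgram', hS,
      Finset.sum_const, Finset.card_univ, nsmul_eq_mul, hP, hβ, smul_eq_mul, one_apply,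
      ite_mul, mul_ite, Finset.sum_ite_eq, Finset.sum_ite_eq', Finset.mem_univ, if_true] <;>
    (try split_ifs) <;> ring

end Matrix

namespace SteinerSystem

open Finset

variable {P : Type*} [DecidableEq P] {B : Finset (Finset P)}

theorem sum_card_inter_eq (s : Finset P) (C : Finset (Finset P)) :
    ∑ d ∈ C, #(s ∩ d) = ∑ x ∈ s, #{d ∈ C | x ∈ d} := by
  simpa [bipartiteAbove, bipartiteBelow, filter_mem_eq_inter] using
    (sum_card_bipartiteAbove_eq_sum_card_bipartiteBelow (s := s) (t := C) (· ∈ ·)).symm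

/-- Double counting of incidences when all members of `C` have six elements. -/
theorem six_mul_card [Fintype P] {C : Finset (Finset P)} (hC : ∀ b ∈ C, #b = 6) :
    6 * #C = ∑ x, #{d ∈ C | x ∈ d} := by
  rw [← sum_card_inter_eq, sum_congr rfl fun b hb => by rw [univ_inter, hC b hb]]
  simp [mul_comm]

theorem card_filter_three (hB : ∀ t : Finset P, #t = 3 → ∃! b, b ∈ B ∧ t ⊆ b) {p q x : P}
    (hpq : p ≠ q) (hpx : p ≠ x) (hqx : q ≠ x) :
    #{d ∈ {d ∈ {d ∈ B | p ∈ d} | q ∈ d} | x ∈ d} = 1 := by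
  obtain ⟨b, hb, huniq⟩ := hB {p, q, x} (card_eq_three.mpr ⟨p, q, x, hpq, hpx, hqx, rfl⟩)
  refine card_eq_one.mpr ⟨b, ?_⟩
  ext d
  simp only [mem_filter, mem_singleton]
  constructor
  · rintro ⟨⟨⟨hd, hp⟩, hq⟩, hx⟩
    exact huniq d ⟨hd, by simp [insert_subset_iff, hp, hq, hx]⟩
  · rintro rfl
    have := hb.2
    simp only [insert_subset_iff, singleton_subset_iff] at this
    exact ⟨⟨⟨hb.1, this.1⟩, this.2.1⟩, this.2.2⟩

theorem card_inter_le (hB : ∀ t : Finset P, #t = 3 → ∃! b, b ∈ B ∧ t ⊆ b) {b c : Finset P}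
    (hb : b ∈ B) (hc : c ∈ B) (hbc : b ≠ c) : #(b ∩ c) ≤ 2 := by
  by_contra! h
  obtain ⟨t, ht, htcard⟩ := exists_subset_card_eq (Nat.succ_le_of_lt h)
  exact hbc ((hB t htcard).unique ⟨hb, ht.trans inter_subset_left⟩
    ⟨hc, ht.trans inter_subset_right⟩)

variable [Fintype P]

theorem card_filter_two (hP : Fintype.card P = 22) (hsize : ∀ b ∈ B, #b = 6)
    (hB : ∀ t : Finset P, #t = 3 → ∃! b, b ∈ B ∧ t ⊆ b) {p q : P} (hpq : p ≠ q) :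
    #{d ∈ {d ∈ B | p ∈ d} | q ∈ d} = 5 := by
  set C : Finset (Finset P) := {d ∈ {d ∈ B | p ∈ d} | q ∈ d} with hC
  have hsix := six_mul_card (C := C) fun b hb => hsize b (by grind)
  have hp : #{d ∈ C | p ∈ d} = #C := by rw [filter_true_of_mem (by grind)]
  have hq : #{d ∈ C | q ∈ d} = #C := by rw [filter_true_of_mem (by grind)]
  have hrest : ∑ x ∈ ({p, q} : Finset P)ᶜ, #{d ∈ C | x ∈ d} = 20 := by
    rw [sum_congr rfl fun x hx => card_filter_three hB hpq (by grind [mem_compl]) (by grind [mem_compl]),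
      sum_const,
      card_compl, card_pair hpq, hP]
    rfl
  rw [← sum_add_sum_compl {p, q}, sum_pair hpq, hp, hq, hrest] at hsix
  omega

theorem card_filter_one (hP : Fintype.card P = 22) (hsize : ∀ b ∈ B, #b = 6)
    (hB : ∀ t : Finset P, #t = 3 → ∃! b, b ∈ B ∧ t ⊆ b) (p : P) :
    #{d ∈ B | p ∈ d} = 21 := by
  set C : Finset (Finset P) := {d ∈ B | p ∈ d} with hC
  have hsix := six_mul_card (C := C) fun b hb => hsize b (by grind)
  have hp : #{d ∈ C | p ∈ d} = #C := by rw [filter_true_of_mem (by grind)]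
  have hrest : ∑ x ∈ ({p} : Finset P)ᶜ, #{d ∈ C | x ∈ d} = 105 := by
    rw [sum_congr rfl fun x hx => card_filter_two hP hsize hB (by grind [mem_compl]), sum_const,
      card_compl, card_singleton, hP]
    rfl
  rw [← sum_add_sum_compl {p}, sum_singleton, hp, hrest] at hsix
  omega

theorem card_blocks (hP : Fintype.card P = 22) (hsize : ∀ b ∈ B, #b = 6)
    (hB : ∀ t : Finset P, #t = 3 → ∃! b, b ∈ B ∧ t ⊆ b) : #B = 77 := by
  have hsix := six_mul_card hsize
  simp only [card_filter_one hP hsize hB, sum_const, card_univ, hP, smul_eq_mul] at hsix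
  omega

/-- Two distinct blocks that meet have exactly two points in common. -/
theorem card_inter_eq_two (hP : Fintype.card P = 22) (hsize : ∀ b ∈ B, #b = 6)
    (hB : ∀ t : Finset P, #t = 3 → ∃! b, b ∈ B ∧ t ⊆ b) {b c : Finset P}
    (hb : b ∈ B) (hc : c ∈ B) (hbc : b ≠ c) (hne : (b ∩ c).Nonempty) : #(b ∩ c) = 2 := by
  obtain ⟨p, hp⟩ := hne
  obtain ⟨hpb, hpc⟩ := mem_inter.mp hp
  obtain ⟨q, hqc, hqb⟩ : ∃ q ∈ c, q ∉ b := by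
    by_contra! h
    exact hbc (eq_of_subset_of_card_le h (by rw [hsize b hb, hsize c hc])).symm
  have hpq : p ≠ q := by rintro rfl; exact hqb hpb
  set C : Finset (Finset P) := {d ∈ {d ∈ B | p ∈ d} | q ∈ d} with hC
  have hCcard : #C = 5 := card_filter_two hP hsize hB hpq
  have hle : ∀ d ∈ C, #(b ∩ d) ≤ 2 := fun d hd =>
    card_inter_le hB hb (by grind) (by rintro rfl; grind)
  have hsum : ∑ d ∈ C, #(b ∩ d) = ∑ d ∈ C, 2 := by
    rw [sum_card_inter_eq, ← add_sum_erase _ _ hpb, filter_true_of_mem (s := C) (by grind),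
      sum_congr rfl fun x hx => card_filter_three hB hpq (by grind) (by grind)]
    simp [hCcard, card_erase_of_mem hpb, hsize b hb]
  exact (sum_eq_sum_iff_of_le hle).mp hsum c (by grind)

/-- The point-block incidence matrix over `ZMod 3`. -/
def incidence (B : Finset (Finset P)) : Matrix P {b // b ∈ B} (ZMod 3) :=
  Matrix.of fun p b => if p ∈ b.1 then 1 else 0

theorem incidence_gram (b c : {b // b ∈ B}) :
    ((incidence B).transpose * incidence B) b c = #(b.1 ∩ c.1) := by
  simp [Matrix.mul_apply, incidence, ← ite_and, ← mem_inter, inter_comm]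

theorem sum_incidence_col (hsize : ∀ b ∈ B, #b = 6) (b : {b // b ∈ B}) :
    ∑ p, incidence B p b = 0 := by
  simp only [incidence, Matrix.of_apply, sum_boole, filter_univ_mem, hsize b.1 b.2]
  decide

theorem sum_incidence_row (hP : Fintype.card P = 22) (hsize : ∀ b ∈ B, #b = 6)
    (hB : ∀ t : Finset P, #t = 3 → ∃! b, b ∈ B ∧ t ⊆ b) (p : P) :
    ∑ b, incidence B p b = 0 := by
  have h := sum_coe_sort B fun b => if p ∈ b then (1 : ZMod 3) else 0
  simp only [incidence, Matrix.of_apply]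
  rw [h, sum_boole, card_filter_one hP hsize hB]
  decide

theorem incidence_mul_transpose (hP : Fintype.card P = 22) (hsize : ∀ b ∈ B, #b = 6)
    (hB : ∀ t : Finset P, #t = 3 → ∃! b, b ∈ B ∧ t ⊆ b) :
    incidence B * (incidence B).transpose = 1 - Matrix.of fun _ _ => 1 := by
  ext p q
  have h := sum_coe_sort B fun b => if q ∈ b then if p ∈ b then (1 : ZMod 3) else 0 else 0
  simp only [Matrix.mul_apply, incidence, Matrix.transpose_apply, Matrix.of_apply, mul_ite,
    mul_one, mul_zero, Matrix.sub_apply, Matrix.one_apply]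
  rw [h]
  by_cases hpq : p = q
  · subst hpq
    simp only [← ite_and, and_self, sum_boole, card_filter_one hP hsize hB]
    decide
  · have h5 := card_filter_two hP hsize hB hpq
    rw [filter_filter] at h5
    simp only [← ite_and, and_comm, sum_boole, h5, hpq]
    decide

/-- Over `ZMod 3`, the Higman–Sims graph satisfies `A + I = borderedGram N` for the incidence
matrix `N`, because distinct blocks meet in `0` or `2` points. -/
theorem adjMatrix_higmanSims_add_one [DecidableRel (higmanSims P B).Adj]
    (hP : Fintype.card P = 22) (hsize : ∀ b ∈ B, #b = 6)
    (hB : ∀ t : Finset P, #t = 3 → ∃! b, b ∈ B ∧ t ⊆ b) :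
    (higmanSims P B).adjMatrix (ZMod 3) + 1 = Matrix.borderedGram (incidence B) := by
  ext x y
  rw [Matrix.add_apply, SimpleGraph.adjMatrix_apply]
  rcases x with _ | p | b <;> rcases y with _ | q | c
  case some.inr.some.inr =>
    by_cases hbc : b = c
    · subst hbc
      simp only [Matrix.borderedGram, incidence_gram, inter_self,
        hsize b.1 b.2, SimpleGraph.irrefl, Matrix.one_apply_eq]
      decide
    · have hbc' : b.1 ≠ c.1 := fun h => hbc (Subtype.ext h)
      by_cases hdisj : b.1 ∩ c.1 = ∅
      · simp [Matrix.borderedGram, incidence_gram, higmanSims, hbc, hdisj]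
      · have h2 := card_inter_eq_two hP hsize hB b.2 c.2 hbc' (nonempty_iff_ne_empty.mpr hdisj)
        simp only [Matrix.borderedGram, incidence_gram, h2]
        simp [higmanSims, hbc, hdisj, inter_comm c.1]
        decide
  all_goals
    simp [Matrix.borderedGram, higmanSims, incidence, Matrix.one_apply]

end SteinerSystem

open scoped Classical in
/-- For the Higman–Sims graph with adjacency matrix A and
M = A + I over F_3 = ZMod 3, we have M² = 2M; in particular M is diagonalisable
over F_3. -/
theorem higmanSims_adjMatrix_add_one_sq {P : Type*} [Fintype P] [DecidableEq P]
    (hP : Fintype.card P = 22) (B : Finset (Finset P))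
    (hsize : ∀ b ∈ B, b.card = 6)
    (hsteiner : ∀ t : Finset P, t.card = 3 → ∃! b, b ∈ B ∧ t ⊆ b) :
    ((higmanSims P B).adjMatrix (ZMod 3) + 1) * ((higmanSims P B).adjMatrix (ZMod 3) + 1) =
        (2 : ZMod 3) • ((higmanSims P B).adjMatrix (ZMod 3) + 1) ∧
      ∃ Q : Matrix (HSVertex P B) (HSVertex P B) (ZMod 3), IsUnit Q ∧
        (Q⁻¹ * ((higmanSims P B).adjMatrix (ZMod 3) + 1) * Q).IsDiag := by
  have hsq : ((higmanSims P B).adjMatrix (ZMod 3) + 1) *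
      ((higmanSims P B).adjMatrix (ZMod 3) + 1) =
        (2 : ZMod 3) • ((higmanSims P B).adjMatrix (ZMod 3) + 1) := by
    rw [SteinerSystem.adjMatrix_higmanSims_add_one hP hsize hsteiner]
    refine Matrix.borderedGram_mul_self ?_ ?_ (SteinerSystem.sum_incidence_col hsize)
      (SteinerSystem.sum_incidence_row hP hsize hsteiner)
      (SteinerSystem.incidence_mul_transpose hP hsize hsteiner)
    · rw [hP]; decide
    · rw [Fintype.card_coe, SteinerSystem.card_blocks hP hsize hsteiner]; decide
  refine ⟨hsq, ?_⟩
  have hidem : IsIdempotentElem (-((higmanSims P B).adjMatrix (ZMod 3) + 1)) := by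
    rw [IsIdempotentElem, neg_mul_neg, hsq, ← neg_one_smul (ZMod 3)]
    congr 1
  obtain ⟨Q, hQ, hdiag⟩ := Matrix.exists_isUnit_isDiag_of_isIdempotentElem hidem
  refine ⟨Q, hQ, ?_⟩
  simpa only [mul_neg, neg_mul, neg_neg] using hdiag.neg
end
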